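/- Let n ≥ 1 be an integer and fix i with 0 ≤ i < n. For every Schwartz function φ : EuclideanSpace ℝ (Fin n) → ℝ, ∫ (fderiv ℝ G_n x (e i)) · (φ(x) − Δφ(x)) dx = −(fderiv ℝ φ 0 (e i)), where the integrand is defined for x ≠ 0 (hence almost everywhere) and the integral is with respect to Lebesgue measure. -/

import Mathlib

open MeasureTheory Real SchwartzMap

/-- The Bessel potential `G_n` on `ℝⁿ`. -/
noncomputable def besselG (n : ℕ) (x : EuclideanSpace ℝ (Fin n)) : ℝ :=
  ∫ t in Set.Ioi (0 : ℝ), (4 * Real.pi * t) ^ (-(n : ℝ) / 2) *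
    Real.exp (-(‖x‖ ^ 2) / (4 * t) - t)

/-- Pointwise Laplacian of `f : ℝⁿ → ℝ`. -/
noncomputable def ptLaplacian {n : ℕ} (f : EuclideanSpace ℝ (Fin n) → ℝ)
    (x : EuclideanSpace ℝ (Fin n)) : ℝ :=
  ∑ i : Fin n, iteratedDeriv 2 (fun t : ℝ => f (x + t • EuclideanSpace.single i (1 : ℝ))) 0

open FourierTransform LineDeriv Laplacian

section Schwartz

variable {E : Type*} [NormedAddCommGroup E] [InnerProductSpace ℝ E]

theorem SchwartzMap.iteratedDeriv_two_line (φ : 𝓢(E, ℝ)) (x e : E) :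
    iteratedDeriv 2 (fun t : ℝ => φ (x + t • e)) 0 = ∂_{e} (∂_{e} φ) x := by
  have key : ∀ (f : 𝓢(E, ℝ)) (t : ℝ),
      HasDerivAt (fun t : ℝ => f (x + t • e)) ((∂_{e} f) (x + t • e)) t := by
    intro f t
    have hline : HasDerivAt (fun t : ℝ => x + t • e) e t := by
      simpa using ((hasDerivAt_id t).smul_const e).const_add x
    exact (f.hasFDerivAt (x + t • e)).comp_hasDerivAt t hline
  rw [iteratedDeriv_succ, iteratedDeriv_one, funext fun t => (key φ t).deriv, (key _ 0).deriv]
  simp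

/-- A real Schwartz function regarded as a complex one. -/
noncomputable def SchwartzMap.complexify (φ : 𝓢(E, ℝ)) : 𝓢(E, ℂ) :=
  φ.postcompCLM Complex.ofRealCLM

theorem SchwartzMap.complexify_apply (φ : 𝓢(E, ℝ)) (x : E) : φ.complexify x = (φ x : ℂ) := rfl

theorem SchwartzMap.complexify_sub (φ ψ : 𝓢(E, ℝ)) :
    (φ - ψ).complexify = φ.complexify - ψ.complexify :=
  map_sub _ φ ψ

theorem SchwartzMap.lineDerivOp_complexify (φ : 𝓢(E, ℝ)) (e : E) :
    ∂_{e} φ.complexify = (∂_{e} φ).complexify := by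
  ext x
  rw [lineDerivOp_apply_eq_fderiv]
  have h : HasFDerivAt φ.complexify (Complex.ofRealCLM ∘L fderiv ℝ φ x) x :=
    Complex.ofRealCLM.hasFDerivAt.comp x (φ.hasFDerivAt x)
  rw [h.fderiv]
  rfl

variable [FiniteDimensional ℝ E]

theorem SchwartzMap.laplacian_complexify (φ : 𝓢(E, ℝ)) :
    Δ φ.complexify = (Δ φ).complexify := by
  rw [laplacian_eq_sum (stdOrthonormalBasis ℝ E), laplacian_eq_sum (stdOrthonormalBasis ℝ E)]
  simp_rw [lineDerivOp_complexify]
  exact (map_sum (postcompCLM Complex.ofRealCLM) _ _).symm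

variable [MeasurableSpace E] [BorelSpace E]

theorem SchwartzMap.fourier_laplacian_apply (f : 𝓢(E, ℂ)) (ξ : E) :
    𝓕 (Δ f) ξ = -((4 * π ^ 2 * ‖ξ‖ ^ 2 : ℝ) : ℂ) * 𝓕 f ξ := by
  rw [laplacian_eq_fourierMultiplierCLM, FourierTransform.fourier_smul, fourierMultiplierCLM_apply,
    FourierTransform.fourier_fourierInv_eq, smul_apply, smulLeftCLM_apply_apply (by fun_prop)]
  simp
  ring

theorem SchwartzMap.fourier_lineDerivOp_sub_laplacian (f : 𝓢(E, ℂ)) (e ξ : E) :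
    𝓕 (∂_{e} (f - Δ f)) ξ = ((1 + 4 * π ^ 2 * ‖ξ‖ ^ 2 : ℝ) : ℂ) * 𝓕 (∂_{e} f) ξ := by
  have he : (inner ℝ · e : E → ℝ).HasTemperateGrowth := ((innerSL ℝ).flip e).hasTemperateGrowth
  rw [fourier_lineDerivOp_eq, fourier_lineDerivOp_eq, smul_apply, smul_apply,
    smulLeftCLM_apply_apply he, smulLeftCLM_apply_apply he, sub_eq_add_neg,
    ← neg_one_smul ℂ, FourierTransform.fourier_add, FourierTransform.fourier_smul, add_apply,
    smul_apply, fourier_laplacian_apply]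
  simp
  ring

theorem SchwartzMap.integral_fourier (f : 𝓢(E, ℂ)) : ∫ ξ, 𝓕 f ξ = f 0 := by
  have h := congrArg (fun g : 𝓢(E, ℂ) => g 0)
    (FourierTransform.fourierInv_fourier_eq (F := 𝓢(E, ℂ)) f)
  simp only [fourierInv_coe, Real.fourierInv_eq'] at h
  simpa using h

end Schwartz

theorem ptLaplacian_eq_laplacian {n : ℕ} (φ : 𝓢(EuclideanSpace ℝ (Fin n), ℝ))
    (x : EuclideanSpace ℝ (Fin n)) : ptLaplacian φ x = (Δ φ) x := by
  rw [SchwartzMap.laplacian_eq_sum (EuclideanSpace.basisFun (Fin n) ℝ), sum_apply]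
  simp [ptLaplacian, SchwartzMap.iteratedDeriv_two_line]

/-- The Gauss–Weierstrass heat kernel on `ℝⁿ`. -/
noncomputable def heatKernel (n : ℕ) (t : ℝ) (x : EuclideanSpace ℝ (Fin n)) : ℝ :=
  (4 * π * t) ^ (-(n : ℝ) / 2) * rexp (-(‖x‖ ^ 2) / (4 * t))

section HeatKernel

variable {n : ℕ} {t : ℝ}

theorem integrable_exp_neg_mul_sq_norm {b : ℝ} (hb : 0 < b) :
    Integrable fun x : EuclideanSpace ℝ (Fin n) => rexp (-b * ‖x‖ ^ 2) := by
  refine Integrable.of_integral_ne_zero ?_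
  rw [GaussianFourier.integral_rexp_neg_mul_sq_norm hb]
  positivity

theorem heatKernel_eq_fourier (ht : 0 < t) (x : EuclideanSpace ℝ (Fin n)) :
    (heatKernel n t x : ℂ) =
      𝓕 (fun ξ : EuclideanSpace ℝ (Fin n) => Complex.exp (-((4 * π ^ 2 * t : ℝ) : ℂ) * ‖ξ‖ ^ 2))
        x := by
  have hb : 0 < 4 * π ^ 2 * t := by positivity
  rw [fourier_gaussian_innerProductSpace (by rwa [Complex.ofReal_re]), heatKernel,
    Complex.ofReal_mul]
  congr 1
  · have h : (4 * π * t) ^ (-(n : ℝ) / 2) = (π / (4 * π ^ 2 * t)) ^ ((n : ℝ) / 2) := by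
      rw [neg_div, Real.rpow_neg (by positivity), ← Real.inv_rpow (by positivity)]
      congr 1
      field_simp
    rw [h, Complex.ofReal_cpow (by positivity)]
    simp
  · rw [Complex.ofReal_exp]
    congr 1
    push_cast
    field_simp

theorem integral_heatKernel_mul (ht : 0 < t) (f : 𝓢(EuclideanSpace ℝ (Fin n), ℝ)) :
    ((∫ x, heatKernel n t x * f x : ℝ) : ℂ) =
      ∫ ξ : EuclideanSpace ℝ (Fin n), (rexp (-(4 * π ^ 2 * t) * ‖ξ‖ ^ 2) : ℂ) *
        (𝓕 f.complexify : 𝓢(EuclideanSpace ℝ (Fin n), ℂ)) ξ := by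
  have hb : 0 < 4 * π ^ 2 * t := by positivity
  have hg : Integrable fun ξ : EuclideanSpace ℝ (Fin n) =>
      Complex.exp (-((4 * π ^ 2 * t : ℝ) : ℂ) * ‖ξ‖ ^ 2) := by
    simpa using (integrable_exp_neg_mul_sq_norm (n := n) hb).ofReal (𝕜 := ℂ)
  have h := VectorFourier.integral_fourierIntegral_smul_eq_flip
    (L := innerₗ (EuclideanSpace ℝ (Fin n))) (μ := volume) (ν := volume)
    Real.continuous_fourierChar continuous_inner hg (f.complexify.integrable (μ := volume))
  rw [← integral_complex_ofReal]
  refine Eq.trans (integral_congr_ae (.of_forall fun x => ?_)) (h.trans ?_)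
  · simp only [Complex.ofReal_mul, heatKernel_eq_fourier ht]
    rfl
  · rw [flip_innerₗ]
    refine integral_congr_ae (.of_forall fun x => ?_)
    simp [SchwartzMap.fourier_coe]
    rfl

theorem integral_exp_neg_mul_heat_average (φ : 𝓢(EuclideanSpace ℝ (Fin n), ℝ))
    (e : EuclideanSpace ℝ (Fin n)) :
    ∫ t in Set.Ioi (0 : ℝ), rexp (-t) * ∫ x, heatKernel n t x * (∂_{e} (φ - Δ φ)) x =
      (∂_{e} φ) 0 := by
  set F : 𝓢(EuclideanSpace ℝ (Fin n), ℂ) := 𝓕 (∂_{e} (φ - Δ φ)).complexify with hF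
  have hFint : Integrable F := F.integrable
  have hF' : ∀ ξ, F ξ = ((1 + 4 * π ^ 2 * ‖ξ‖ ^ 2 : ℝ) : ℂ) *
      (𝓕 (∂_{e} φ).complexify : 𝓢(EuclideanSpace ℝ (Fin n), ℂ)) ξ := by
    intro ξ
    rw [hF, ← SchwartzMap.lineDerivOp_complexify, SchwartzMap.complexify_sub,
      ← SchwartzMap.laplacian_complexify, SchwartzMap.fourier_lineDerivOp_sub_laplacian,
      SchwartzMap.lineDerivOp_complexify]
  have hprod : Integrable (fun p : ℝ × EuclideanSpace ℝ (Fin n) =>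
      ((rexp (-p.1) : ℝ) : ℂ) * ((rexp (-(4 * π ^ 2 * p.1) * ‖p.2‖ ^ 2) : ℂ) * F p.2))
      ((volume.restrict (Set.Ioi 0)).prod volume) := by
    have hexp : Integrable (fun t : ℝ => ((rexp (-t) : ℝ) : ℂ)) (volume.restrict (Set.Ioi 0)) :=
      (integrableOn_exp_neg_Ioi 0).ofReal
    refine (hexp.mul_prod hFint).mono ?_ ?_
    · have := F.continuous
      exact Continuous.aestronglyMeasurable (by fun_prop)
    · have : ∀ᵐ p : ℝ × EuclideanSpace ℝ (Fin n) ∂((volume.restrict (Set.Ioi 0)).prod volume),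
        0 < p.1 :=
        Measure.quasiMeasurePreserving_fst.ae (ae_restrict_mem measurableSet_Ioi)
      filter_upwards [this] with p hp
      simp only [norm_mul, Complex.norm_real, Real.norm_eq_abs, Real.abs_exp]
      gcongr
      refine mul_le_of_le_one_left (norm_nonneg _) (Real.exp_le_one_iff.2 ?_)
      have : 0 ≤ 4 * π ^ 2 * p.1 * ‖p.2‖ ^ 2 := by positivity
      linarith
  apply Complex.ofReal_injective
  rw [← integral_complex_ofReal]
  calc ∫ t in Set.Ioi (0 : ℝ),
        ((rexp (-t) * ∫ x, heatKernel n t x * (∂_{e} (φ - Δ φ)) x : ℝ) : ℂ)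
      = ∫ t in Set.Ioi (0 : ℝ), ∫ ξ : EuclideanSpace ℝ (Fin n),
          ((rexp (-t) : ℝ) : ℂ) * ((rexp (-(4 * π ^ 2 * t) * ‖ξ‖ ^ 2) : ℂ) * F ξ) := by
        refine setIntegral_congr_fun measurableSet_Ioi fun t ht => ?_
        rw [Complex.ofReal_mul, integral_heatKernel_mul ht, integral_const_mul]
    _ = ∫ ξ, ∫ t in Set.Ioi (0 : ℝ),
          ((rexp (-t) : ℝ) : ℂ) * ((rexp (-(4 * π ^ 2 * t) * ‖ξ‖ ^ 2) : ℂ) * F ξ) :=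
        integral_integral_swap hprod
    _ = ∫ ξ, (𝓕 (∂_{e} φ).complexify : 𝓢(EuclideanSpace ℝ (Fin n), ℂ)) ξ := by
        refine integral_congr_ae (.of_forall fun ξ => ?_)
        have hc : 0 < 1 + 4 * π ^ 2 * ‖ξ‖ ^ 2 := by positivity
        have hint : ∫ t in Set.Ioi (0 : ℝ), rexp (-(1 + 4 * π ^ 2 * ‖ξ‖ ^ 2) * t) =
            (1 + 4 * π ^ 2 * ‖ξ‖ ^ 2)⁻¹ := by
          rw [integral_exp_mul_Ioi (by linarith), mul_zero, Real.exp_zero, neg_div_neg_eq, one_div]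
        have hrw : ∀ t : ℝ, ((rexp (-t) : ℝ) : ℂ) *
            ((rexp (-(4 * π ^ 2 * t) * ‖ξ‖ ^ 2) : ℂ) * F ξ) =
            ((rexp (-(1 + 4 * π ^ 2 * ‖ξ‖ ^ 2) * t) : ℝ) : ℂ) * F ξ := by
          intro t
          rw [← mul_assoc, ← Complex.ofReal_mul, ← Real.exp_add]
          ring_nf
        simp_rw [hrw]
        rw [integral_mul_const, integral_complex_ofReal, hint, hF', ← mul_assoc,
          ← Complex.ofReal_mul, inv_mul_cancel₀ hc.ne']
        simp
    _ = _ := by rw [SchwartzMap.integral_fourier, SchwartzMap.complexify_apply]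

theorem heatKernel_pos (ht : 0 < t) (x : EuclideanSpace ℝ (Fin n)) : 0 < heatKernel n t x := by
  unfold heatKernel
  positivity

theorem heatKernel_eq (t : ℝ) (x : EuclideanSpace ℝ (Fin n)) :
    heatKernel n t x = (4 * π * t) ^ (-(n : ℝ) / 2) * rexp (-(4 * t)⁻¹ * ‖x‖ ^ 2) := by
  rw [heatKernel]
  congr 2
  rw [neg_div, neg_mul, div_eq_inv_mul]

theorem integrable_heatKernel (ht : 0 < t) :
    Integrable fun x : EuclideanSpace ℝ (Fin n) => heatKernel n t x := by
  simp_rw [heatKernel_eq]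
  exact (integrable_exp_neg_mul_sq_norm (by positivity)).const_mul _

theorem integral_heatKernel (ht : 0 < t) :
    ∫ x : EuclideanSpace ℝ (Fin n), heatKernel n t x = 1 := by
  simp_rw [heatKernel_eq]
  rw [integral_const_mul, GaussianFourier.integral_rexp_neg_mul_sq_norm (by positivity),
    finrank_euclideanSpace_fin, div_inv_eq_mul, neg_div, Real.rpow_neg (by positivity),
    show π * (4 * t) = 4 * π * t by ring, inv_mul_cancel₀ (by positivity)]

theorem hasFDerivAt_heatKernel (t : ℝ) (x : EuclideanSpace ℝ (Fin n)) :
    HasFDerivAt (heatKernel n t) ((-(heatKernel n t x / (2 * t))) • innerSL ℝ x) x := by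
  have h := (((hasStrictFDerivAt_norm_sq x).hasFDerivAt.const_mul (-(4 * t)⁻¹)).exp).const_mul
    ((4 * π * t) ^ (-(n : ℝ) / 2))
  rw [funext (heatKernel_eq t)]
  refine h.congr_fderiv ?_
  ext y
  simp
  ring

theorem fderiv_heatKernel_single (t : ℝ) (x : EuclideanSpace ℝ (Fin n)) (i : Fin n) :
    fderiv ℝ (heatKernel n t) x (EuclideanSpace.single i 1) =
      -(x i / (2 * t)) * heatKernel n t x := by
  rw [(hasFDerivAt_heatKernel t x).fderiv]
  simp [EuclideanSpace.inner_single_right]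
  ring

theorem abs_fderiv_heatKernel_single_le (ht : 0 < t) (x : EuclideanSpace ℝ (Fin n)) (i : Fin n) :
    |fderiv ℝ (heatKernel n t) x (EuclideanSpace.single i 1)| ≤
      2 ^ ((n : ℝ) / 2) * (t ^ ((1 / 2 : ℝ) - 1) * heatKernel n (2 * t) x) := by
  have hs : 0 < √t := Real.sqrt_pos.2 ht
  have hsq : √t ^ 2 = t := Real.sq_sqrt ht.le
  have hpow : t ^ ((1 / 2 : ℝ) - 1) = (√t)⁻¹ := by
    rw [show (1 / 2 : ℝ) - 1 = -(1 / 2) by norm_num, Real.rpow_neg ht.le, Real.sqrt_eq_rpow]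
  have hker : heatKernel n t x =
      2 ^ ((n : ℝ) / 2) * heatKernel n (2 * t) x * rexp (-(‖x‖ ^ 2 / (8 * t))) := by
    have h2 : (2 : ℝ) ^ ((n : ℝ) / 2) * 2 ^ (-(n : ℝ) / 2) = 1 := by
      rw [← Real.rpow_add two_pos, neg_div, add_neg_cancel, Real.rpow_zero]
    rw [heatKernel, heatKernel, show 4 * π * (2 * t) = 2 * (4 * π * t) by ring,
      Real.mul_rpow two_pos.le (by positivity),
      show -(‖x‖ ^ 2) / (4 * t) = -(‖x‖ ^ 2) / (4 * (2 * t)) + -(‖x‖ ^ 2 / (8 * t)) by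
        field_simp; ring, Real.exp_add]
    linear_combination (-((4 * π * t) ^ (-(n : ℝ) / 2) * (rexp (-(‖x‖ ^ 2) / (4 * (2 * t))) *
      rexp (-(‖x‖ ^ 2 / (8 * t)))))) * h2
  have hlin : |x i| / (2 * t) * rexp (-(‖x‖ ^ 2 / (8 * t))) ≤ (√t)⁻¹ := by
    have hxi : |x i| ≤ ‖x‖ := PiLp.norm_apply_le x i
    have hexp := Real.add_one_le_exp (‖x‖ ^ 2 / (8 * t))
    rw [Real.exp_neg, ← div_eq_mul_inv, div_le_iff₀ (Real.exp_pos _)]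
    calc |x i| / (2 * t) ≤ ‖x‖ / (2 * t) := by gcongr
      _ = (√t)⁻¹ * (‖x‖ / √t / 2) := by field_simp; rw [hsq]
      _ ≤ (√t)⁻¹ * ((‖x‖ / √t) ^ 2 / 8 + 1) := by
        gcongr
        nlinarith [sq_nonneg (‖x‖ / √t - 2)]
      _ ≤ (√t)⁻¹ * rexp (‖x‖ ^ 2 / (8 * t)) := by
        gcongr
        refine le_trans (le_of_eq ?_) hexp
        rw [div_pow, hsq]
        field_simp
  have hpos := (heatKernel_pos (n := n) (show 0 < 2 * t by positivity) x).le
  rw [fderiv_heatKernel_single, abs_mul, abs_neg, abs_div, abs_of_pos (heatKernel_pos ht x),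
    abs_of_pos (show 0 < 2 * t by positivity), hpow, hker]
  calc |x i| / (2 * t) * (2 ^ ((n : ℝ) / 2) * heatKernel n (2 * t) x * rexp (-(‖x‖ ^ 2 / (8 * t))))
      = 2 ^ ((n : ℝ) / 2) * (|x i| / (2 * t) * rexp (-(‖x‖ ^ 2 / (8 * t)))) *
          heatKernel n (2 * t) x := by ring
    _ ≤ 2 ^ ((n : ℝ) / 2) * (√t)⁻¹ * heatKernel n (2 * t) x := by gcongr
    _ = _ := by ring

theorem measurable_heatKernel : Measurable fun p : ℝ × EuclideanSpace ℝ (Fin n) =>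
    heatKernel n p.1 p.2 := by
  unfold heatKernel
  fun_prop

theorem measurable_fderiv_heatKernel_single (i : Fin n) :
    Measurable fun p : ℝ × EuclideanSpace ℝ (Fin n) =>
      fderiv ℝ (heatKernel n p.1) p.2 (EuclideanSpace.single i 1) := by
  simp_rw [fderiv_heatKernel_single]
  have : Measurable fun p : ℝ × EuclideanSpace ℝ (Fin n) => heatKernel n p.1 p.2 :=
    measurable_heatKernel
  fun_prop

theorem integrable_exp_neg_mul_fderiv_heatKernel (i : Fin n)
    (f : 𝓢(EuclideanSpace ℝ (Fin n), ℝ)) :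
    Integrable (fun p : ℝ × EuclideanSpace ℝ (Fin n) => rexp (-p.1) *
      (fderiv ℝ (heatKernel n p.1) p.2 (EuclideanSpace.single i 1) * f p.2))
      ((volume.restrict (Set.Ioi 0)).prod volume) := by
  have hdom : Integrable (fun p : ℝ × EuclideanSpace ℝ (Fin n) =>
      (rexp (-p.1) * p.1 ^ ((1 / 2 : ℝ) - 1)) * heatKernel n (2 * p.1) p.2)
      ((volume.restrict (Set.Ioi 0)).prod volume) := by
    have hmeas : Measurable fun p : ℝ × EuclideanSpace ℝ (Fin n) =>
        heatKernel n (2 * p.1) p.2 :=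
      measurable_heatKernel.comp (by fun_prop : Measurable fun p : ℝ × EuclideanSpace ℝ (Fin n) =>
        (2 * p.1, p.2))
    refine (integrable_prod_iff (Measurable.aestronglyMeasurable (by fun_prop))).2 ⟨?_, ?_⟩
    · filter_upwards [ae_restrict_mem measurableSet_Ioi] with t ht
      exact (integrable_heatKernel (mul_pos two_pos ht)).const_mul _
    · refine (Real.GammaIntegral_convergent (s := 1 / 2) (by norm_num)).congr_fun
        (fun t (ht : 0 < t) => ?_) measurableSet_Ioi
      have hpos : 0 < rexp (-t) * t ^ ((1 / 2 : ℝ) - 1) := by positivity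
      simp only [norm_mul _ (heatKernel _ _ _), Real.norm_of_nonneg hpos.le,
        Real.norm_of_nonneg (heatKernel_pos (mul_pos two_pos ht) _).le]
      rw [integral_const_mul, integral_heatKernel (mul_pos two_pos ht), mul_one]
  obtain ⟨C, hC⟩ : ∃ C, ∀ x, ‖f x‖ ≤ C := ⟨_, f.norm_le_seminorm ℝ⟩
  refine (hdom.const_mul (2 ^ ((n : ℝ) / 2) * C)).mono' ?_ ?_
  · have hf := f.continuous.measurable
    have hK := measurable_fderiv_heatKernel_single i
    exact Measurable.aestronglyMeasurable (by fun_prop)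
  · have hpos : ∀ᵐ p : ℝ × EuclideanSpace ℝ (Fin n)
        ∂((volume.restrict (Set.Ioi 0)).prod volume), 0 < p.1 :=
      Measure.quasiMeasurePreserving_fst.ae (ae_restrict_mem measurableSet_Ioi)
    filter_upwards [hpos] with p hp
    have hK := abs_fderiv_heatKernel_single_le hp p.2 i
    rw [← Real.norm_eq_abs] at hK
    rw [norm_mul, norm_mul, Real.norm_of_nonneg (Real.exp_pos _).le]
    calc rexp (-p.1) * (‖fderiv ℝ (heatKernel n p.1) p.2 (EuclideanSpace.single i 1)‖ * ‖f p.2‖)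
        ≤ rexp (-p.1) * ((2 ^ ((n : ℝ) / 2) * (p.1 ^ ((1 / 2 : ℝ) - 1) *
            heatKernel n (2 * p.1) p.2)) * C) := by
          gcongr
          · exact (norm_nonneg _).trans hK
          · exact hC _
      _ = _ := by ring

theorem integral_fderiv_heatKernel_mul (ht : 0 < t) (i : Fin n)
    (f : 𝓢(EuclideanSpace ℝ (Fin n), ℝ)) :
    ∫ x, fderiv ℝ (heatKernel n t) x (EuclideanSpace.single i 1) * f x =
      -∫ x, heatKernel n t x * (∂_{EuclideanSpace.single i (1 : ℝ)} f) x := by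
  have hbdd : ∀ g : 𝓢(EuclideanSpace ℝ (Fin n), ℝ), ∃ C, ∀ x, ‖g x‖ ≤ C :=
    fun g => ⟨_, g.norm_le_seminorm ℝ⟩
  have hK : Integrable fun x : EuclideanSpace ℝ (Fin n) =>
      fderiv ℝ (heatKernel n t) x (EuclideanSpace.single i 1) := by
    refine (((integrable_heatKernel (mul_pos two_pos ht)).const_mul (t ^ ((1 / 2 : ℝ) - 1))).const_mul
      (2 ^ ((n : ℝ) / 2))).mono' ?_ (.of_forall fun x => abs_fderiv_heatKernel_single_le ht x i)
    exact ((measurable_fderiv_heatKernel_single i).comp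
      (measurable_const.prodMk measurable_id : Measurable fun x => (t, x))).aestronglyMeasurable
  have hmul : ∀ {k : EuclideanSpace ℝ (Fin n) → ℝ}, Integrable k →
      ∀ g : 𝓢(EuclideanSpace ℝ (Fin n), ℝ), Integrable fun x => k x * g x := by
    intro k hk g
    obtain ⟨C, hC⟩ := hbdd g
    exact hk.mul_bdd g.continuous.aestronglyMeasurable (.of_forall hC)
  have h := integral_mul_fderiv_eq_neg_fderiv_mul_of_integrable (hmul hK f)
    (hmul (integrable_heatKernel ht) (∂_{EuclideanSpace.single i (1 : ℝ)} f))
    (hmul (integrable_heatKernel ht) f)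
    (fun x _ => (hasFDerivAt_heatKernel t x).differentiableAt) (fun x _ => f.differentiableAt)
  simp only [SchwartzMap.lineDerivOp_apply_eq_fderiv]
  rw [h, neg_neg]

end HeatKernel

section BesselPotential

variable {n : ℕ}

/-- The integrand of the Bessel potential at a point of squared norm `s`. -/
noncomputable def besselIntegrand (n : ℕ) (s t : ℝ) : ℝ :=
  (4 * π * t) ^ (-(n : ℝ) / 2) * rexp (-s / (4 * t) - t)

theorem measurable_besselIntegrand (s : ℝ) : Measurable (besselIntegrand n s) := by
  unfold besselIntegrand
  fun_prop

theorem exists_rpow_neg_mul_exp_neg_div_le {a c : ℝ} (ha : 0 < a) (hc : 0 < c) :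
    ∃ C, ∀ t, 0 < t → t ^ (-a) * rexp (-c / t) ≤ C := by
  refine ⟨(a / c) ^ a, fun t ht => ?_⟩
  have h1 : c / (a * t) ≤ rexp (c / (a * t)) := by
    linarith [Real.add_one_le_exp (c / (a * t))]
  have h2 : (c / (a * t)) ^ a ≤ rexp (c / t) := by
    calc (c / (a * t)) ^ a ≤ rexp (c / (a * t)) ^ a := by gcongr
      _ = rexp (c / t) := by rw [← Real.exp_mul]; congr 1; field_simp
  have h3 : t ^ (-a) = (a / c) ^ a * (c / (a * t)) ^ a := by
    rw [← Real.mul_rpow (by positivity) (by positivity), Real.rpow_neg ht.le,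
      ← Real.inv_rpow ht.le]
    congr 1
    field_simp
  rw [neg_div, Real.exp_neg, h3, mul_assoc]
  refine mul_le_of_le_one_right (by positivity) ?_
  rw [← div_eq_mul_inv, div_le_one (Real.exp_pos _)]
  exact h2

theorem integrableOn_rpow_neg_mul_exp {a c : ℝ} (ha : 0 < a) (hc : 0 < c) :
    IntegrableOn (fun t : ℝ => t ^ (-a) * rexp (-c / t - t)) (Set.Ioi 0) := by
  obtain ⟨C, hC⟩ := exists_rpow_neg_mul_exp_neg_div_le ha hc
  refine ((integrableOn_exp_neg_Ioi 0).const_mul C).mono'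
    (Measurable.aestronglyMeasurable (by fun_prop)) ?_
  filter_upwards [ae_restrict_mem measurableSet_Ioi] with t ht
  have ht : 0 < t := ht
  rw [Real.norm_of_nonneg (by positivity), sub_eq_add_neg, Real.exp_add, ← mul_assoc]
  gcongr
  exact hC t ht

theorem besselIntegrand_eq {s t : ℝ} (ht : 0 < t) : besselIntegrand n s t =
    (4 * π) ^ (-(n : ℝ) / 2) * (t ^ (-((n : ℝ) / 2)) * rexp (-(s / 4) / t - t)) := by
  rw [besselIntegrand, Real.mul_rpow (by positivity) ht.le, mul_assoc, ← neg_div ((2 : ℝ))]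
  congr 4
  field_simp

theorem integrableOn_besselIntegrand (hn : 1 ≤ n) {s : ℝ} (hs : 0 < s) :
    IntegrableOn (besselIntegrand n s) (Set.Ioi 0) := by
  have hn' : (0 : ℝ) < n / 2 := by positivity
  exact IntegrableOn.congr_fun
    ((integrableOn_rpow_neg_mul_exp hn' (by positivity : 0 < s / 4)).const_mul _)
    (fun t ht => (besselIntegrand_eq ht).symm) measurableSet_Ioi

theorem integrableOn_besselIntegrand_div {s : ℝ} (hs : 0 < s) :
    IntegrableOn (fun t => (4 * t)⁻¹ * besselIntegrand n s t) (Set.Ioi 0) := by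
  have hn' : (0 : ℝ) < n / 2 + 1 := by positivity
  refine IntegrableOn.congr_fun ((integrableOn_rpow_neg_mul_exp hn'
    (by positivity : 0 < s / 4)).const_mul (4⁻¹ * (4 * π) ^ (-(n : ℝ) / 2)))
    (fun t (ht : 0 < t) => ?_) measurableSet_Ioi
  simp only [besselIntegrand_eq ht]
  rw [neg_add, Real.rpow_add ht, Real.rpow_neg_one]
  field_simp

theorem hasDerivAt_integral_besselIntegrand (hn : 1 ≤ n) {s : ℝ} (hs : 0 < s) :
    HasDerivAt (fun s => ∫ t in Set.Ioi 0, besselIntegrand n s t)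
      (∫ t in Set.Ioi 0, -(4 * t)⁻¹ * besselIntegrand n s t) s := by
  refine (hasDerivAt_integral_of_dominated_loc_of_deriv_le (s := Set.Ioi (s / 2))
    (F' := fun s t => -(4 * t)⁻¹ * besselIntegrand n s t)
    (bound := fun t => (4 * t)⁻¹ * besselIntegrand n (s / 2) t)
    (Ioi_mem_nhds (by linarith)) (.of_forall fun r => ?_) (integrableOn_besselIntegrand hn hs) ?_ ?_
    (integrableOn_besselIntegrand_div (by linarith)) ?_).2
  · exact (measurable_besselIntegrand r).aestronglyMeasurable
  · have := measurable_besselIntegrand (n := n) s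
    exact Measurable.aestronglyMeasurable (by fun_prop)
  · filter_upwards [ae_restrict_mem measurableSet_Ioi] with t ht r hr
    have ht : 0 < t := ht
    have hr : s / 2 < r := hr
    unfold besselIntegrand
    rw [norm_mul, norm_neg, Real.norm_of_nonneg (by positivity), Real.norm_of_nonneg (by positivity)]
    gcongr
  · refine .of_forall fun t r _ => ?_
    unfold besselIntegrand
    refine HasDerivAt.congr_deriv
      (((((hasDerivAt_id r).neg.div_const (4 * t)).sub_const t).exp).const_mul
      ((4 * π * t) ^ (-(n : ℝ) / 2))) ?_
    simp
    ring

theorem fderiv_besselG_single (hn : 1 ≤ n) {x : EuclideanSpace ℝ (Fin n)} (hx : x ≠ 0)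
    (i : Fin n) :
    fderiv ℝ (besselG n) x (EuclideanSpace.single i 1) =
      ∫ t in Set.Ioi (0 : ℝ), rexp (-t) *
        fderiv ℝ (heatKernel n t) x (EuclideanSpace.single i 1) := by
  have hpos : 0 < ‖x‖ ^ 2 := by positivity
  have h := (hasDerivAt_integral_besselIntegrand hn hpos).comp_hasFDerivAt x
    (hasStrictFDerivAt_norm_sq x).hasFDerivAt
  change HasFDerivAt (besselG n) _ x at h
  rw [h.fderiv]
  simp only [fderiv_heatKernel_single, smul_apply, innerSL_apply_apply,
    EuclideanSpace.inner_single_right, smul_eq_mul]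
  rw [← integral_mul_const]
  refine integral_congr_ae (.of_forall fun t => ?_)
  simp only [besselIntegrand, heatKernel, sub_eq_add_neg, Real.exp_add]
  simp
  ring

end BesselPotential

/-- Identities (4.102)–(4.103) of Lemma 4.1: `(1 − Δ)(∂ᵢG_n) = ∂ᵢδ₀`, i.e.
`∫ ∂ᵢG_n · (φ − Δφ) = −∂ᵢφ(0)` for every Schwartz function `φ`. -/
theorem stmt11 (n : ℕ) (hn : 1 ≤ n) (i : Fin n)
    (φ : SchwartzMap (EuclideanSpace ℝ (Fin n)) ℝ) :
    ∫ x, (fderiv ℝ (besselG n) x (EuclideanSpace.single i (1 : ℝ))) *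
        (φ x - ptLaplacian (⇑φ) x)
      = -(fderiv ℝ (⇑φ) 0 (EuclideanSpace.single i (1 : ℝ))) := by
  have : NeZero n := ⟨by omega⟩
  set e : EuclideanSpace ℝ (Fin n) := EuclideanSpace.single i (1 : ℝ) with he
  calc ∫ x, (fderiv ℝ (besselG n) x e) * (φ x - ptLaplacian (⇑φ) x)
      = ∫ x, ∫ t in Set.Ioi (0 : ℝ),
          rexp (-t) * (fderiv ℝ (heatKernel n t) x e * (φ - Δ φ) x) := by
        refine integral_congr_ae ?_
        filter_upwards [compl_mem_ae_iff.2 (measure_singleton (0 : EuclideanSpace ℝ (Fin n)))]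
          with x hx
        rw [fderiv_besselG_single hn hx, ptLaplacian_eq_laplacian, ← integral_mul_const]
        simp only [mul_assoc, sub_apply, he]
    _ = ∫ t in Set.Ioi (0 : ℝ), ∫ x,
          rexp (-t) * (fderiv ℝ (heatKernel n t) x e * (φ - Δ φ) x) :=
        (integral_integral_swap (integrable_exp_neg_mul_fderiv_heatKernel i (φ - Δ φ))).symm
    _ = ∫ t in Set.Ioi (0 : ℝ),
          -(rexp (-t) * ∫ x, heatKernel n t x * (∂_{e} (φ - Δ φ)) x) := by
        refine setIntegral_congr_fun measurableSet_Ioi fun t ht => ?_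
        rw [integral_const_mul, integral_fderiv_heatKernel_mul ht, mul_neg]
    _ = -(fderiv ℝ (⇑φ) 0 e) := by rw [integral_neg, integral_exp_neg_mul_heat_average,
        SchwartzMap.lineDerivOp_apply_eq_fderiv]
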